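/- Let q ≥ 1 be an integer, let (s_j)_{j=0}^∞ be a Stieltjes positive definite sequence of complex q×q matrices with associated matrix polynomials P_n, Q_n, P̂_n, Q̂_n, and let P_n^{(1)}, Q_n^{(1)}, P̂_n^{(1)}, Q̂_n^{(1)} be the corresponding polynomials built from the first Kátětov transform (s_j^{(1)})_{j=0}^∞. Then for every n ∈ ℕ and every z ∈ ℂ: P_n^{(1)}(z) [P_n^{(1)}(0)]^{−1} = [s_0^{−1} Q̂_n(z)] [s_0^{−1} Q̂_n(0)]^{−1}; Q_n^{(1)}(z) [P_n^{(1)}(0)]^{−1} = [Q̂_n(z) − s_0 P̂_n(z)] [s_0^{−1} Q̂_n(0)]^{−1}; P̂_{n−1}^{(1)}(z) [Q̂_{n−1}^{(1)}(0)]^{−1} = [s_0^{−1} Q_n(z)] [−s_0 P_n(0)]^{−1}; and Q̂_{n−1}^{(1)}(z) [Q̂_{n−1}^{(1)}(0)]^{−1} = [z Q_n(z) − s_0 P_n(z)] [−s_0 P_n(0)]^{−1}. -/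

import Mathlib

open Matrix
open scoped ComplexOrder

noncomputable section

/-- The space of complex `q × q` matrices. -/
abbrev Mq (q : ℕ) := Matrix (Fin q) (Fin q) ℂ

/-- The space of complex `2q × 2q` matrices, written in `q × q` blocks. -/
abbrev M2q (q : ℕ) := Matrix (Fin q ⊕ Fin q) (Fin q ⊕ Fin q) ℂ

/-- Block Hankel matrix `H_n = (s_{j+k})_{j,k=0}^n`. -/
def Hmat (q : ℕ) (s : ℕ → Mq q) (n : ℕ) :
    Matrix (Fin (n + 1) × Fin q) (Fin (n + 1) × Fin q) ℂ :=
  Matrix.of fun p r => s (p.1.1 + r.1.1) p.2 r.2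

/-- Block Hankel matrix `K_n = (s_{j+k+1})_{j,k=0}^n`. -/
def Kmat (q : ℕ) (s : ℕ → Mq q) (n : ℕ) :
    Matrix (Fin (n + 1) × Fin q) (Fin (n + 1) × Fin q) ℂ :=
  Matrix.of fun p r => s (p.1.1 + r.1.1 + 1) p.2 r.2

/-- A sequence of complex `q × q` matrices is Stieltjes positive definite if all the
block Hankel matrices `H_n` and `K_n` are positive definite (in particular Hermitian). -/
def IsStieltjesPD (q : ℕ) (s : ℕ → Mq q) : Prop :=
  ∀ n : ℕ, (Hmat q s n).PosDef ∧ (Kmat q s n).PosDef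

/-- Even Stieltjes parameters `𝔮_{2k}` (Schur complements `L_k`). -/
def qEven (q : ℕ) (s : ℕ → Mq q) : ℕ → Mq q
  | 0 => s 0
  | k + 1 =>
      s (2 * (k + 1)) -
        (Matrix.of fun (a : Fin q) (r : Fin (k + 1) × Fin q) => s (k + 1 + r.1.1) a r.2) *
          (Hmat q s k)⁻¹ *
          (Matrix.of fun (p : Fin (k + 1) × Fin q) (b : Fin q) => s (k + 1 + p.1.1) p.2 b)

/-- Odd Stieltjes parameters `𝔮_{2k+1}` (Schur complements `Λ_k`). -/
def qOdd (q : ℕ) (s : ℕ → Mq q) : ℕ → Mq q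
  | 0 => s 1
  | k + 1 =>
      s (2 * (k + 1) + 1) -
        (Matrix.of fun (a : Fin q) (r : Fin (k + 1) × Fin q) => s (k + 2 + r.1.1) a r.2) *
          (Kmat q s k)⁻¹ *
          (Matrix.of fun (p : Fin (k + 1) × Fin q) (b : Fin q) => s (k + 2 + p.1.1) p.2 b)

/-- Stieltjes parametrization `𝔮_j`. -/
def qpar (q : ℕ) (s : ℕ → Mq q) (j : ℕ) : Mq q :=
  if j % 2 = 0 then qEven q s (j / 2) else qOdd q s (j / 2)

/-- Reciprocal sequence `s^♯`. -/
def reciprocal (q : ℕ) (s : ℕ → Mq q) : ℕ → Mq q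
  | 0 => (s 0)⁻¹
  | j + 1 =>
      -(s 0)⁻¹ *
        ∑ l ∈ (Finset.range (j + 1)).attach, s (j + 1 - l.1) * reciprocal q s l.1
  decreasing_by exact Finset.mem_range.mp l.2

/-- First Kátětov transform `s^{(1)}_j = −s_0 s_{j+1}^♯ s_0`. -/
def katetov1 (q : ℕ) (s : ℕ → Mq q) : ℕ → Mq q :=
  fun j => -(s 0) * reciprocal q s (j + 1) * s 0

/-- `ℓ`-th Kátětov transform (the `ℓ`-fold iterate of the first Kátětov transform). -/
def katetov (q : ℕ) (ℓ : ℕ) (s : ℕ → Mq q) : ℕ → Mq q :=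
  (katetov1 q)^[ℓ] s

/-- `v_k = col(I_q, 0_{kq×q})`. -/
def vcol (q k : ℕ) : Matrix (Fin (k + 1) × Fin q) (Fin q) ℂ :=
  Matrix.of fun p b => if p.1.1 = 0 ∧ p.2 = b then 1 else 0

/-- `y_{0,k} = col(s_0, …, s_k)`. -/
def ycol (q : ℕ) (s : ℕ → Mq q) (k : ℕ) : Matrix (Fin (k + 1) × Fin q) (Fin q) ℂ :=
  Matrix.of fun p b => s p.1.1 p.2 b

/-- Dyukarev–Stieltjes parameters `𝔐_k`. -/
def DSM (q : ℕ) (s : ℕ → Mq q) : ℕ → Mq q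
  | 0 => (s 0)⁻¹
  | k + 1 =>
      (vcol q (k + 1))ᴴ * (Hmat q s (k + 1))⁻¹ * vcol q (k + 1) -
        (vcol q k)ᴴ * (Hmat q s k)⁻¹ * vcol q k

/-- Dyukarev–Stieltjes parameters `𝔏_k`. -/
def DSL (q : ℕ) (s : ℕ → Mq q) : ℕ → Mq q
  | 0 => s 0 * (s 1)⁻¹ * s 0
  | k + 1 =>
      (ycol q s (k + 1))ᴴ * (Kmat q s (k + 1))⁻¹ * ycol q s (k + 1) -
        (ycol q s k)ᴴ * (Kmat q s k)⁻¹ * ycol q s k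

/-- Ordered product `A_0 A_1 ⋯ A_n`. -/
def oprod {α : Type*} [Monoid α] (f : ℕ → α) (n : ℕ) : α :=
  ((List.range (n + 1)).map f).prod

/-- Block shift `T_n = (δ_{j,k+1} I_q)_{j,k=0}^n`. -/
def Tmat (q n : ℕ) : Matrix (Fin (n + 1) × Fin q) (Fin (n + 1) × Fin q) ℂ :=
  Matrix.of fun p r => if p.1.1 = r.1.1 + 1 ∧ p.2 = r.2 then 1 else 0

/-- `R_n(z) = (I_{(n+1)q} − z T_n)⁻¹`. -/
def Rmat (q n : ℕ) (z : ℂ) : Matrix (Fin (n + 1) × Fin q) (Fin (n + 1) × Fin q) ℂ :=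
  (1 - z • Tmat q n)⁻¹

/-- `u_0 = 0`, `u_n = col(0_{q×q}, −y_{0,n−1})`. -/
def ucol (q : ℕ) (s : ℕ → Mq q) (n : ℕ) : Matrix (Fin (n + 1) × Fin q) (Fin q) ℂ :=
  Matrix.of fun p b => if p.1.1 = 0 then 0 else -(s (p.1.1 - 1) p.2 b)

/-- `col(−H_n⁻¹ y_{n+1,2n+1}, I_q)` of size `(n+2)q × q`. -/
def colH (q : ℕ) (s : ℕ → Mq q) (n : ℕ) : Matrix (Fin (n + 2) × Fin q) (Fin q) ℂ :=
  Matrix.of fun p b =>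
    if h : p.1.1 < n + 1 then
      (-((Hmat q s n)⁻¹ *
          Matrix.of fun (r : Fin (n + 1) × Fin q) (c : Fin q) => s (n + 1 + r.1.1) r.2 c))
        (⟨p.1.1, h⟩, p.2) b
    else if p.2 = b then 1 else 0

/-- `col(−K_n⁻¹ y_{n+2,2n+2}, I_q)` of size `(n+2)q × q`. -/
def colK (q : ℕ) (s : ℕ → Mq q) (n : ℕ) : Matrix (Fin (n + 2) × Fin q) (Fin q) ℂ :=
  Matrix.of fun p b =>
    if h : p.1.1 < n + 1 then
      (-((Kmat q s n)⁻¹ *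
          Matrix.of fun (r : Fin (n + 1) × Fin q) (c : Fin q) => s (n + 2 + r.1.1) r.2 c))
        (⟨p.1.1, h⟩, p.2) b
    else if p.2 = b then 1 else 0

/-- `z_{0,n} = row(s_0, …, s_n)`. -/
def zrow (q : ℕ) (s : ℕ → Mq q) (n : ℕ) : Matrix (Fin q) (Fin (n + 1) × Fin q) ℂ :=
  Matrix.of fun a r => s r.1.1 a r.2

/-- Orthogonal matrix polynomials `P_n`. -/
def Ppoly (q : ℕ) (s : ℕ → Mq q) : ℕ → ℂ → Mq q
  | 0, _ => 1
  | n + 1, z => (vcol q (n + 1))ᴴ * (Rmat q (n + 1) (starRingEnd ℂ z))ᴴ * colH q s n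

/-- Second kind matrix polynomials `Q_n`. -/
def Qpoly (q : ℕ) (s : ℕ → Mq q) : ℕ → ℂ → Mq q
  | 0, _ => 0
  | n + 1, z => -((ucol q s (n + 1))ᴴ * (Rmat q (n + 1) (starRingEnd ℂ z))ᴴ * colH q s n)

/-- Matrix polynomials `P̂_n`. -/
def Phat (q : ℕ) (s : ℕ → Mq q) : ℕ → ℂ → Mq q
  | 0, _ => 1
  | n + 1, z => (vcol q (n + 1))ᴴ * (Rmat q (n + 1) (starRingEnd ℂ z))ᴴ * colK q s n

/-- Matrix polynomials `Q̂_n`. -/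
def Qhat (q : ℕ) (s : ℕ → Mq q) : ℕ → ℂ → Mq q
  | 0, _ => s 0
  | n + 1, z => zrow q s (n + 1) * (Rmat q (n + 1) (starRingEnd ℂ z))ᴴ * colK q s n

/-- `α_n(z)`. -/
def alphaP (q : ℕ) (s : ℕ → Mq q) (n : ℕ) (z : ℂ) : Mq q :=
  1 - z • ((ucol q s n)ᴴ * (Rmat q n (starRingEnd ℂ z))ᴴ * (Hmat q s n)⁻¹ * vcol q n)

/-- `γ_n(z)`. -/
def gammaP (q : ℕ) (s : ℕ → Mq q) (n : ℕ) (z : ℂ) : Mq q :=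
  -(z • ((vcol q n)ᴴ * (Rmat q n (starRingEnd ℂ z))ᴴ * (Hmat q s n)⁻¹ * vcol q n))

/-- `β_n(z)`. -/
def betaP (q : ℕ) (s : ℕ → Mq q) : ℕ → ℂ → Mq q
  | 0, _ => 0
  | n + 1, z => (ycol q s n)ᴴ * (Rmat q n (starRingEnd ℂ z))ᴴ * (Kmat q s n)⁻¹ * ycol q s n

/-- `δ_n(z)`. -/
def deltaP (q : ℕ) (s : ℕ → Mq q) : ℕ → ℂ → Mq q
  | 0, _ => 1
  | n + 1, z =>
      1 + z • ((vcol q n)ᴴ * (Rmat q n (starRingEnd ℂ z))ᴴ * (Kmat q s n)⁻¹ * ycol q s n)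

/-- The resolvent matrices `U_m(z)`. -/
def Umat (q : ℕ) (s : ℕ → Mq q) (m : ℕ) (z : ℂ) : M2q q :=
  if m % 2 = 0 then
    Matrix.fromBlocks (alphaP q s (m / 2) z) (betaP q s (m / 2) z)
      (gammaP q s (m / 2) z) (deltaP q s (m / 2) z)
  else
    Matrix.fromBlocks (alphaP q s (m / 2) z) (betaP q s (m / 2 + 1) z)
      (gammaP q s (m / 2) z) (deltaP q s (m / 2 + 1) z)

/-- `𝕄_k(z) = [[I, 0], [−z𝔐_k, I]]`. -/
def MM (q : ℕ) (s : ℕ → Mq q) (k : ℕ) (z : ℂ) : M2q q :=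
  Matrix.fromBlocks 1 0 (-(z • DSM q s k)) 1

/-- `𝕃_k = [[I, 𝔏_k], [0, I]]`. -/
def LL (q : ℕ) (s : ℕ → Mq q) (k : ℕ) : M2q q :=
  Matrix.fromBlocks 1 (DSL q s k) 0 1

/-- `𝒫_n = diag([P_n(0)]^{−*}, P_n(0))`. -/
def PPmat (q : ℕ) (s : ℕ → Mq q) (n : ℕ) : M2q q :=
  Matrix.fromBlocks (((Ppoly q s n 0)⁻¹)ᴴ) 0 0 (Ppoly q s n 0)

/-- `𝐐_n(z) = [[0, Q̂_n(0)], [−z[Q̂_n(0)]^{−*}, 0]]`. -/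
def QQgen (q : ℕ) (s : ℕ → Mq q) (n : ℕ) (z : ℂ) : M2q q :=
  Matrix.fromBlocks 0 (Qhat q s n 0) (-(z • ((Qhat q s n 0)⁻¹)ᴴ)) 0

/-- `𝐐_0^{(ℓ)}(z) = [[0, s_0^{(ℓ)}], [−z(s_0^{(ℓ)})⁻¹, 0]]`. -/
def QQ0 (q : ℕ) (s : ℕ → Mq q) (ℓ : ℕ) (z : ℂ) : M2q q :=
  Matrix.fromBlocks 0 (katetov q ℓ s 0) (-(z • (katetov q ℓ s 0)⁻¹)) 0

/-- `𝒬_m(z) = 𝐐_0^{(0)}(z) ⋯ 𝐐_0^{(m)}(z)`. -/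
def Qprod (q : ℕ) (s : ℕ → Mq q) (m : ℕ) (z : ℂ) : M2q q :=
  oprod (fun ℓ => QQ0 q s ℓ z) m

/-! ### Power series helpers -/

/-- Truncation of a power series, as a power series. -/
def tr {q : ℕ} (N : ℕ) (f : PowerSeries (Mq q)) : PowerSeries (Mq q) :=
  PowerSeries.mk fun i => if i < N then PowerSeries.coeff i f else 0

/-- Reversed evaluation. -/
def ev {q : ℕ} (N : ℕ) (f : PowerSeries (Mq q)) (z : ℂ) : Mq q :=
  ∑ m ∈ Finset.range N, z ^ (N - 1 - m) • PowerSeries.coeff m f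

lemma coeff_tr {q : ℕ} (N i : ℕ) (f : PowerSeries (Mq q)) :
    PowerSeries.coeff i (tr N f) = if i < N then PowerSeries.coeff i f else 0 := by
  simp [tr]

lemma coeff_mul_congr {q : ℕ} {N : ℕ} {f g : PowerSeries (Mq q)} (h : PowerSeries (Mq q))
    (H : ∀ i < N, PowerSeries.coeff i f = PowerSeries.coeff i g) :
    ∀ i < N, PowerSeries.coeff i (h * f) = PowerSeries.coeff i (h * g) := by
  intro i hi
  rw [PowerSeries.coeff_mul, PowerSeries.coeff_mul]
  apply Finset.sum_congr rfl
  intro x hx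
  rw [H]
  have := Finset.HasAntidiagonal.mem_antidiagonal.mp hx
  omega

/-- Uniqueness property. -/
def UU {q : ℕ} (σ : PowerSeries (Mq q)) (n a : ℕ) : Prop :=
  ∀ p : PowerSeries (Mq q), PowerSeries.coeff 0 p = 0 → (∀ i, n < i → PowerSeries.coeff i p = 0) →
    (∀ m, n + a ≤ m → m < 2 * n + a → PowerSeries.coeff m (σ * p) = 0) → p = 0

/-- Orthogonality property. -/
def OP {q : ℕ} (σ : PowerSeries (Mq q)) (n a : ℕ) (p : PowerSeries (Mq q)) : Prop :=
  PowerSeries.coeff 0 p = 1 ∧ (∀ i, n < i → PowerSeries.coeff i p = 0) ∧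
    (∀ m, n + a ≤ m → m < 2 * n + a → PowerSeries.coeff m (σ * p) = 0)

lemma OP_unique {q : ℕ} {σ : PowerSeries (Mq q)} {n a : ℕ} (hU : UU σ n a)
    {p p' : PowerSeries (Mq q)} (h : OP σ n a p) (h' : OP σ n a p') : p = p' := by
  rw [← sub_eq_zero]
  apply hU
  · rw [map_sub, h.1, h'.1, sub_self]
  · intro i hi
    rw [map_sub, h.2.1 i hi, h'.2.1 i hi, sub_self]
  · intro m h1 h2
    rw [mul_sub, map_sub, h.2.2 m h1 h2, h'.2.2 m h1 h2, sub_self]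

lemma UU_transfer {q : ℕ} {σ τ : PowerSeries (Mq q)} {c d : Mq q} (hcd : d * c = 1)
    (hR : σ * (PowerSeries.C d * (PowerSeries.X * τ)) = σ - PowerSeries.C c)
    {n a a' : ℕ} (ha : a + a' = 1) (hU : UU σ (n + a) a') : UU τ n a := by
  intro p h0 hs ho
  have hXt : ∀ i < 2 * n + a + 1, PowerSeries.coeff i (tr (n + a + 1) (PowerSeries.X * (τ * p)))
      = PowerSeries.coeff i (PowerSeries.X * (τ * p)) := by
    intro i hi
    rw [coeff_tr]
    split_ifs with h
    · rfl
    · obtain ⟨j, rfl⟩ : ∃ j, i = j + 1 := ⟨i - 1, by omega⟩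
      rw [PowerSeries.coeff_succ_X_mul, ho j (by omega) (by omega)]
  have key : ∀ i < 2 * n + a + 1,
      PowerSeries.coeff i (σ * (p - PowerSeries.C d * tr (n + a + 1) (PowerSeries.X * (τ * p))))
       = c * PowerSeries.coeff i p := by
    intro i hi
    have h1 := coeff_mul_congr (σ * PowerSeries.C d) hXt i hi
    have h2 : σ * p - (σ * PowerSeries.C d) * (PowerSeries.X * (τ * p)) = PowerSeries.C c * p := by
      have : (σ * PowerSeries.C d) * (PowerSeries.X * (τ * p))
        = (σ * (PowerSeries.C d * (PowerSeries.X * τ))) * p := by noncomm_ring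
      rw [this, hR]; noncomm_ring
    rw [mul_sub, ← mul_assoc, map_sub, h1, ← map_sub, h2, PowerSeries.coeff_C_mul]
  have hz : p - PowerSeries.C d * tr (n + a + 1) (PowerSeries.X * (τ * p)) = 0 := by
    apply hU
    · rw [map_sub, h0, PowerSeries.coeff_C_mul, coeff_tr, PowerSeries.coeff_zero_X_mul]; simp
    · intro i hi
      rw [map_sub, hs i (by omega), PowerSeries.coeff_C_mul, coeff_tr, if_neg (by omega)]; simp
    · intro m h1 h2
      rw [key m (by omega), hs m (by omega), mul_zero]
  rw [hz] at key
  ext1 i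
  by_cases hi : n < i
  · rw [hs i hi]; simp
  · have := key i (by omega)
    simp only [mul_zero, map_zero] at this
    have h3 : d * (c * PowerSeries.coeff i p) = 0 := by rw [← this, mul_zero]
    rw [← mul_assoc, hcd, one_mul] at h3
    rw [h3]; simp

lemma OP_transfer {q : ℕ} {σ τ : PowerSeries (Mq q)} {c d : Mq q} (hcd : d * c = 1)
    (h0 : PowerSeries.coeff 0 σ = c)
    (hL : (PowerSeries.X * τ) * (PowerSeries.C d * σ) = σ - PowerSeries.C c)
    {n n' a a' : ℕ} (ha : a + a' = 1) (hn : n' + 1 = n + a) {p : PowerSeries (Mq q)}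
    (hp : OP σ n a p) :
    (∀ m, m + 1 < 2 * n + a → PowerSeries.coeff m (τ * (PowerSeries.C d * tr (n + a) (σ * p))) =
      PowerSeries.coeff (m + 1) (tr (n + a) (σ * p)) - c * PowerSeries.coeff (m + 1) p) ∧
    OP τ n' a' (PowerSeries.C d * tr (n + a) (σ * p)) := by
  obtain ⟨p0, ps, po⟩ := hp
  have hT : ∀ i < 2 * n + a, PowerSeries.coeff i (tr (n + a) (σ * p))
      = PowerSeries.coeff i (σ * p) := by
    intro i hi
    rw [coeff_tr]
    split_ifs with h
    · rfl
    · rw [po i (by omega) hi]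
  have key : ∀ m, m + 1 < 2 * n + a →
      PowerSeries.coeff m (τ * (PowerSeries.C d * tr (n + a) (σ * p))) =
      PowerSeries.coeff (m + 1) (tr (n + a) (σ * p)) - c * PowerSeries.coeff (m + 1) p := by
    intro m hm
    have h1 := coeff_mul_congr (PowerSeries.X * τ * PowerSeries.C d) hT (m + 1) hm
    have h2 : PowerSeries.X * τ * PowerSeries.C d * (σ * p) = σ * p - PowerSeries.C c * p := by
      have : PowerSeries.X * τ * PowerSeries.C d * (σ * p)
        = (PowerSeries.X * τ) * (PowerSeries.C d * σ) * p := by noncomm_ring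
      rw [this, hL]; noncomm_ring
    rw [← PowerSeries.coeff_succ_X_mul, ← mul_assoc, ← mul_assoc, h1, h2, map_sub, hT _ hm,
      PowerSeries.coeff_C_mul]
  refine ⟨key, ?_, ?_, ?_⟩
  · rw [PowerSeries.coeff_C_mul, coeff_tr, if_pos (by omega), PowerSeries.coeff_mul]
    simp only [Finset.Nat.antidiagonal_zero, Finset.sum_singleton]
    rw [h0, p0, mul_one, hcd]
  · intro i hi
    rw [PowerSeries.coeff_C_mul, coeff_tr, if_neg (by omega), mul_zero]
  · intro m h1 h2
    rw [key m (by omega), coeff_tr, if_neg (by omega), ps (m + 1) (by omega)]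
    simp

/-! ### The reciprocal series -/

lemma recip_right {q : ℕ} (s : ℕ → Mq q) (h : IsUnit (s 0)) :
    PowerSeries.mk s * PowerSeries.mk (reciprocal q s) = 1 := by
  have h1 : s 0 * (s 0)⁻¹ = 1 := Matrix.mul_nonsing_inv _ ((Matrix.isUnit_iff_isUnit_det _).mp h)
  ext1 m
  rw [PowerSeries.coeff_mul]
  simp only [PowerSeries.coeff_mk]
  rw [← Finset.Nat.sum_antidiagonal_swap]
  simp only [Prod.fst_swap, Prod.snd_swap]
  rw [Finset.Nat.sum_antidiagonal_eq_sum_range_succ (fun i j => s j * reciprocal q s i)]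
  cases m with
  | zero => simp [reciprocal, h1]
  | succ j =>
    rw [Finset.sum_range_succ, reciprocal,
      Finset.sum_attach (Finset.range (j + 1)) (fun l => s (j + 1 - l) * reciprocal q s l)]
    rw [Nat.sub_self, ← mul_assoc, mul_neg, h1]
    simp [PowerSeries.coeff_one]

lemma recip_left {q : ℕ} (s : ℕ → Mq q) (h : IsUnit (s 0)) :
    PowerSeries.mk (reciprocal q s) * PowerSeries.mk s = 1 := by
  have h1 := recip_right s h
  have h0 : IsUnit (reciprocal q s 0) := by
    rw [reciprocal]; exact (Matrix.isUnit_nonsing_inv_iff).mpr h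
  have h2 := recip_right (reciprocal q s) h0
  have h3 := left_inv_eq_right_inv h1 h2
  rw [h3]; exact h2

lemma X_mul_kat {q : ℕ} (s : ℕ → Mq q) (h : IsUnit (s 0)) :
    PowerSeries.X * PowerSeries.mk (katetov1 q s) = PowerSeries.C (s 0) -
      PowerSeries.C (s 0) * PowerSeries.mk (reciprocal q s) * PowerSeries.C (s 0) := by
  have h1 : s 0 * (s 0)⁻¹ = 1 := Matrix.mul_nonsing_inv _ ((Matrix.isUnit_iff_isUnit_det _).mp h)
  ext1 m
  rw [map_sub, PowerSeries.coeff_mul_C, PowerSeries.coeff_C_mul, PowerSeries.coeff_mk]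
  cases m with
  | zero => rw [PowerSeries.coeff_zero_X_mul]; simp [reciprocal, h1]
  | succ j => rw [PowerSeries.coeff_succ_X_mul]; simp [katetov1]

lemma kat_L {q : ℕ} (s : ℕ → Mq q) (h : IsUnit (s 0)) :
    (PowerSeries.X * PowerSeries.mk (katetov1 q s)) * (PowerSeries.C (s 0)⁻¹ * PowerSeries.mk s) =
      PowerSeries.mk s - PowerSeries.C (s 0) := by
  have h1 : s 0 * (s 0)⁻¹ = 1 := Matrix.mul_nonsing_inv _ ((Matrix.isUnit_iff_isUnit_det _).mp h)
  have h2 : (PowerSeries.C (s 0) : PowerSeries (Mq q)) * PowerSeries.C (s 0)⁻¹ = 1 := by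
    rw [← map_mul, h1, map_one]
  rw [X_mul_kat s h, sub_mul, ← mul_assoc, h2, one_mul, mul_assoc, ← mul_assoc (PowerSeries.C (s 0)) (PowerSeries.C (s 0)⁻¹),
    h2, one_mul, mul_assoc, recip_left s h, mul_one]

lemma kat_R {q : ℕ} (s : ℕ → Mq q) (h : IsUnit (s 0)) :
    PowerSeries.mk s * (PowerSeries.C (s 0)⁻¹ * (PowerSeries.X * PowerSeries.mk (katetov1 q s))) =
      PowerSeries.mk s - PowerSeries.C (s 0) := by
  have h1 : (s 0)⁻¹ * s 0 = 1 := Matrix.nonsing_inv_mul _ ((Matrix.isUnit_iff_isUnit_det _).mp h)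
  have h2 : (PowerSeries.C (s 0)⁻¹ : PowerSeries (Mq q)) * PowerSeries.C (s 0) = 1 := by
    rw [← map_mul, h1, map_one]
  rw [X_mul_kat s h, mul_sub, h2, mul_assoc (PowerSeries.C (s 0)), ← mul_assoc (PowerSeries.C (s 0)⁻¹), h2, one_mul,
    mul_sub, mul_one, ← mul_assoc, recip_right s h, one_mul]

lemma kat_herm {q : ℕ} (s : ℕ → Mq q) (h : IsUnit (s 0)) (hs : ∀ j, (s j)ᴴ = s j) (j : ℕ) :
    (katetov1 q s j)ᴴ = katetov1 q s j := by
  have key : ∀ j, (reciprocal q s j)ᴴ = reciprocal q s j := by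
    have : PowerSeries.mk (fun j => (reciprocal q s j)ᴴ) * PowerSeries.mk s = 1 := by
      have h1 := recip_right s h
      ext1 m
      have h2 := congrArg (fun f => (PowerSeries.coeff m f)ᴴ) h1
      simp only [PowerSeries.coeff_mul, PowerSeries.coeff_mk, Matrix.conjTranspose_sum,
        Matrix.conjTranspose_mul, hs] at h2 ⊢
      rw [← Finset.Nat.sum_antidiagonal_swap]
      simp only [Prod.fst_swap, Prod.snd_swap]
      rw [h2, PowerSeries.coeff_one]
      split_ifs <;> simp
    have h3 := left_inv_eq_right_inv this (recip_right s h)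
    intro j
    have h4 := congrArg (PowerSeries.coeff j) h3
    simpa using h4
  simp [katetov1, key, hs, mul_assoc]

/-! ### Hankel matrices -/

lemma coeff_conv {q : ℕ} (s : ℕ → Mq q) (n m : ℕ) (p : PowerSeries (Mq q))
    (hp : ∀ i, n < i → PowerSeries.coeff i p = 0) :
    PowerSeries.coeff (n + m) (PowerSeries.mk s * p) =
      ∑ k ∈ Finset.range (n + 1), s (m + k) * PowerSeries.coeff (n - k) p := by
  rw [PowerSeries.coeff_mul, ← Finset.Nat.sum_antidiagonal_swap]
  simp only [Prod.fst_swap, Prod.snd_swap, PowerSeries.coeff_mk]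
  rw [Finset.Nat.sum_antidiagonal_eq_sum_range_succ (fun i j => s j * PowerSeries.coeff i p)]
  rw [← Finset.sum_range_reflect (fun k => s (m + k) * PowerSeries.coeff (n - k) p)]
  symm
  apply Finset.sum_subset_zero_on_sdiff
  · intro x; simp; omega
  · intro x hx
    simp at hx
    rw [hp x (by omega), mul_zero]
  · intro x hx
    simp at hx
    congr 2
    · omega
    · congr 1; omega

/-- Reversed series of a block column. -/
def rev {q : ℕ} (n : ℕ) (c : Matrix (Fin (n + 1) × Fin q) (Fin q) ℂ) : PowerSeries (Mq q) :=
  PowerSeries.mk fun i => if i ≤ n then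
    Matrix.of fun a b => c (⟨n - i, by omega⟩, a) b else 0

lemma coeff_rev {q : ℕ} (n : ℕ) (c : Matrix (Fin (n + 1) × Fin q) (Fin q) ℂ) (k : Fin (n + 1)) :
    PowerSeries.coeff (n - k.1) (rev n c) = Matrix.of fun a b => c (k, a) b := by
  have hk := k.2
  rw [rev, PowerSeries.coeff_mk, if_pos (by omega)]
  ext a b
  simp only [Matrix.of_apply]
  congr 2
  ext
  simp only
  omega

lemma coeff_rev_gt {q : ℕ} (n : ℕ) (c : Matrix (Fin (n + 1) × Fin q) (Fin q) ℂ) (i : ℕ)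
    (hi : n < i) : PowerSeries.coeff i (rev n c) = 0 := by
  rw [rev, PowerSeries.coeff_mk, if_neg (by omega)]

lemma UU_of_isUnit {q : ℕ} (s : ℕ → Mq q) (n a : ℕ)
    (h : ∀ k, k + 1 = n → IsUnit (Hmat q (fun j => s (j + a)) k)) : UU (PowerSeries.mk s) n a := by
  intro p p0 ps po
  cases n with
  | zero =>
    ext1 i
    rcases Nat.eq_zero_or_pos i with rfl | hi
    · rw [p0]; simp
    · rw [ps i hi]; simp
  | succ k =>
    have hu := h k rfl
    let B : Matrix (Fin (k + 1) × Fin q) (Fin q) ℂ :=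
      Matrix.of fun x b => PowerSeries.coeff (k + 1 - x.1.1) p x.2 b
    have hB : Hmat q (fun j => s (j + a)) k * B = 0 := by
      ext x b
      have h1 := po (k + 1 + (x.1.1 + a)) (by omega) (by have := x.1.2; omega)
      rw [coeff_conv s (k + 1) _ p ps, Finset.sum_range_succ, Nat.sub_self, p0, mul_zero, add_zero,
        Finset.sum_range] at h1
      have h2 := congrFun (congrFun h1 x.2) b
      rw [Matrix.sum_apply] at h2
      rw [Matrix.mul_apply, Fintype.sum_prod_type]
      refine Eq.trans ?_ h2
      refine Finset.sum_congr rfl fun y _ => ?_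
      rw [Matrix.mul_apply]
      refine Finset.sum_congr rfl fun c _ => ?_
      simp only [Hmat, B, Matrix.of_apply]
      rw [show x.1.1 + y.1 + a = x.1.1 + a + y.1 by omega]
    have hB0 : B = 0 := by
      have h3 : (Hmat q (fun j => s (j + a)) k)⁻¹ * (Hmat q (fun j => s (j + a)) k * B) = 0 := by
        rw [hB, Matrix.mul_zero]
      rwa [← Matrix.mul_assoc, Matrix.nonsing_inv_mul _ ((Matrix.isUnit_iff_isUnit_det _).mp hu),
        Matrix.one_mul] at h3
    ext1 i
    rcases Nat.eq_zero_or_pos i with rfl | hi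
    · rw [p0]; simp
    · by_cases hi2 : k + 1 < i
      · rw [ps i hi2]; simp
      · ext x b
        have h4 := congrFun (congrFun hB0 (⟨k + 1 - i, by omega⟩, x)) b
        simp only [B, Matrix.of_apply] at h4
        rw [show k + 1 - (k + 1 - i) = i by omega] at h4
        rw [h4]; simp

lemma isUnit_of_UU {q : ℕ} (s : ℕ → Mq q) (n a : ℕ) (h : UU (PowerSeries.mk s) (n + 1) a) :
    IsUnit (Hmat q (fun j => s (j + a)) n) := by
  rw [← Matrix.mulVec_injective_iff_isUnit]
  refine (injective_iff_map_eq_zero (Matrix.mulVecLin (Hmat q (fun j => s (j + a)) n))).mpr ?_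
  intro v hv
  let c : Matrix (Fin (n + 2) × Fin q) (Fin q) ℂ :=
    Matrix.of fun x _ => if h : x.1.1 < n + 1 then v (⟨x.1.1, h⟩, x.2) else 0
  have hc := h (rev (n + 1) c) ?_ (coeff_rev_gt _ _) ?_
  · ext x
    have h1 := coeff_rev (n + 1) c x.1.castSucc
    rw [hc, map_zero] at h1
    have h2 := congrFun (congrFun h1 x.2) x.2
    simp [c] at h2
    exact (h2 (by have := x.1.2; omega)).symm
  · have h1 := coeff_rev (n + 1) c (Fin.last _)
    simp only [Fin.val_last, Nat.sub_self] at h1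
    rw [h1]
    ext x b
    simp [c]
  · intro m h1 h2
    obtain ⟨j, rfl⟩ : ∃ j, m = n + 1 + (j + a) := ⟨m - (n + 1) - a, by omega⟩
    rw [coeff_conv s (n + 1) _ _ (coeff_rev_gt _ _), Finset.sum_range]
    simp only [coeff_rev]
    rw [Fin.sum_univ_castSucc]
    ext x b
    have h3 := congrFun hv (⟨j, by omega⟩, x)
    simp only [Matrix.mulVecLin_apply, Matrix.mulVec, dotProduct, Fintype.sum_prod_type] at h3
    rw [Matrix.add_apply, Matrix.sum_apply]
    simp only [Matrix.mul_apply]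
    simp [c]
    simp [Hmat] at h3
    refine Eq.trans ?_ h3
    refine Finset.sum_congr rfl fun y _ => ?_
    rw [if_pos (by have := y.2; omega)]
    refine Finset.sum_congr rfl fun e _ => ?_
    rw [show j + y.1 + a = j + a + y.1 by omega]

lemma OP_colH {q : ℕ} (s : ℕ → Mq q) (n a : ℕ) (hu : IsUnit (Hmat q (fun j => s (j + a)) n)) :
    OP (PowerSeries.mk s) (n + 1) a (rev (n + 1) (colH q (fun j => s (j + a)) n)) := by
  refine ⟨?_, coeff_rev_gt _ _, ?_⟩
  · have h1 := coeff_rev (n + 1) (colH q (fun j => s (j + a)) n) (Fin.last _)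
    simp only [Fin.val_last, Nat.sub_self] at h1
    rw [h1]
    ext x b
    simp [colH, Matrix.one_apply]
  · intro m h1 h2
    obtain ⟨j, rfl⟩ : ∃ j, m = n + 1 + (j + a) := ⟨m - (n + 1) - a, by omega⟩
    rw [coeff_conv s (n + 1) _ _ (coeff_rev_gt _ _), Finset.sum_range]
    simp only [coeff_rev]
    rw [Fin.sum_univ_castSucc]
    let Y : Matrix (Fin (n + 1) × Fin q) (Fin q) ℂ :=
      Matrix.of fun (r : Fin (n + 1) × Fin q) (c : Fin q) => s (n + 1 + r.1.1 + a) r.2 c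
    have h3 : Hmat q (fun j => s (j + a)) n * (-((Hmat q (fun j => s (j + a)) n)⁻¹ * Y)) + Y = 0 := by
      rw [Matrix.mul_neg, ← Matrix.mul_assoc,
        Matrix.mul_nonsing_inv _ ((Matrix.isUnit_iff_isUnit_det _).mp hu), Matrix.one_mul,
        neg_add_cancel]
    ext x b
    have h4 := congrFun (congrFun h3 (⟨j, by omega⟩, x)) b
    rw [Matrix.add_apply, Matrix.mul_apply, Fintype.sum_prod_type] at h4
    rw [Matrix.add_apply, Matrix.sum_apply]
    refine Eq.trans ?_ h4
    congr 1
    · refine Finset.sum_congr rfl fun y _ => ?_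
      rw [Matrix.mul_apply]
      refine Finset.sum_congr rfl fun e _ => ?_
      congr 1
      · simp only [Hmat, Matrix.of_apply, Fin.val_castSucc]
        rw [show j + y.1 + a = j + a + y.1 by omega]
      · have hy := y.2
        simp only [colH, Matrix.of_apply, Fin.val_castSucc, dif_pos hy]
        rfl
    · rw [Matrix.mul_apply]
      simp [colH, Y]
      rw [show j + a + (n + 1) = n + 1 + j + a by omega]

/-! ### Resolvent -/

/-- Explicit inverse of `1 - z Tᴴ`. -/
def Gm (q n : ℕ) (z : ℂ) : Matrix (Fin (n + 1) × Fin q) (Fin (n + 1) × Fin q) ℂ :=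
  Matrix.of fun p r => if p.1.1 ≤ r.1.1 ∧ p.2 = r.2 then z ^ (r.1.1 - p.1.1) else 0

lemma Rmat_eq (q n : ℕ) (z : ℂ) : (Rmat q n (starRingEnd ℂ z))ᴴ = Gm q n z := by
  rw [Rmat, Matrix.conjTranspose_nonsing_inv]
  apply Matrix.inv_eq_right_inv
  have h0 : (1 - (starRingEnd ℂ) z • Tmat q n)ᴴ = 1 - z • (Tmat q n)ᴴ := by
    simp [Matrix.conjTranspose_sub, Matrix.conjTranspose_smul]
  rw [h0, Matrix.sub_mul, Matrix.one_mul, Matrix.smul_mul]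
  ext ⟨p, i⟩ ⟨r, j⟩
  rw [Matrix.sub_apply, Matrix.smul_apply, Matrix.mul_apply]
  by_cases hp : p.1 + 1 < n + 1
  · rw [Finset.sum_eq_single ((⟨p.1 + 1, hp⟩ : Fin (n + 1)), i)]
    · simp only [Gm, Tmat, Matrix.of_apply, Matrix.conjTranspose_apply, Matrix.one_apply,
        Prod.mk.injEq, Fin.ext_iff]
      by_cases hij : i = j
      · by_cases h1 : p.1 + 1 ≤ r.1
        · have : p.1 ≠ r.1 := by omega
          have h2 : p.1 ≤ r.1 := by omega
          simp [hij, h1, this, h2]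
          rw [← pow_succ', show r.1 - (p.1 + 1) + 1 = r.1 - p.1 by omega, sub_self]
        · by_cases h2 : p.1 = r.1
          · simp [hij, h2]
          · have h3 : ¬ p.1 ≤ r.1 := by omega
            simp [h1, h2, h3]
      · have hij' : ¬ i.1 = j.1 := fun h => hij (Fin.ext h)
        simp [hij']
    · rintro ⟨x, y⟩ _ hne
      simp only [Tmat, Matrix.of_apply, Matrix.conjTranspose_apply]
      rw [if_neg]
      · simp
      · rintro ⟨h1, h2⟩
        apply hne
        simp only [Prod.mk.injEq, Fin.ext_iff] at *
        omega
    · simp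
  · rw [Finset.sum_eq_zero]
    · have := r.2
      have h1 : (p.1 ≤ r.1) = (p.1 = r.1) := by
        apply propext; omega
      simp only [Gm, Matrix.of_apply, Matrix.one_apply, Prod.mk.injEq, Fin.ext_iff, h1]
      by_cases h2 : p.1 = r.1 <;> simp [h2]
    · rintro ⟨x, y⟩ _
      simp only [Tmat, Matrix.of_apply, Matrix.conjTranspose_apply]
      rw [if_neg]
      · simp
      · rintro ⟨h1, h2⟩
        have := x.2
        omega

lemma ev_reindex {q : ℕ} (n : ℕ) (z : ℂ) (f : ℕ → Mq q) (p : PowerSeries (Mq q)) :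
    ∑ k ∈ Finset.range (n + 1), ∑ x ∈ Finset.range (n + 1),
      (if x ≤ k then z ^ (k - x) • (f x * PowerSeries.coeff (n - k) p) else 0) =
    ev (n + 1) (PowerSeries.mk f * p) z := by
  simp only [ev, PowerSeries.coeff_mul, PowerSeries.coeff_mk]
  simp only [Finset.smul_sum, ← Finset.sum_filter]
  rw [Finset.sum_sigma', Finset.sum_sigma']
  refine Finset.sum_bij' (fun y _ => ⟨y.2 + (n - y.1), (y.2, n - y.1)⟩)
    (fun y _ => ⟨n - y.2.2, y.2.1⟩) ?_ ?_ ?_ ?_ ?_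
  · rintro ⟨k, x⟩ h
    simp at h ⊢
    omega
  · rintro ⟨m, x, l⟩ h
    simp at h ⊢
    omega
  · rintro ⟨k, x⟩ h
    simp at h ⊢
    omega
  · rintro ⟨m, x, l⟩ h
    simp at h ⊢
    refine ⟨by omega, ?_⟩
    omega
  · rintro ⟨k, x⟩ h
    simp at h ⊢
    rw [show n - (x + (n - k)) = k - x by omega]

lemma evalRow {q : ℕ} (n : ℕ) (z : ℂ) (f : ℕ → Mq q)
    (A : Matrix (Fin q) (Fin (n + 1) × Fin q) ℂ) (hA : ∀ a r, A a r = f r.1.1 a r.2)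
    (c : Matrix (Fin (n + 1) × Fin q) (Fin q) ℂ) :
    A * (Rmat q n (starRingEnd ℂ z))ᴴ * c = ev (n + 1) (PowerSeries.mk f * rev n c) z := by
  rw [← ev_reindex, Rmat_eq, Finset.sum_range]
  simp only [coeff_rev, Finset.sum_range]
  ext a b
  rw [Matrix.mul_apply, Fintype.sum_prod_type, Matrix.sum_apply]
  refine Finset.sum_congr rfl fun k _ => ?_
  have h1 : ∀ j, (A * Gm q n z) a (k, j) =
      ∑ x : Fin (n + 1), if x.1 ≤ k.1 then z ^ (k.1 - x.1) * f x.1 a j else 0 := by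
    intro j
    rw [Matrix.mul_apply, Fintype.sum_prod_type]
    refine Finset.sum_congr rfl fun x _ => ?_
    simp only [hA, Gm, Matrix.of_apply]
    by_cases hx : x.1 ≤ k.1
    · simp [hx, mul_comm]
    · simp [hx]
  simp only [h1, Finset.sum_mul, Matrix.sum_apply]
  rw [Finset.sum_comm]
  refine Finset.sum_congr rfl fun x _ => ?_
  by_cases hx : x.1 ≤ k.1
  · simp [hx, Matrix.mul_apply, Finset.mul_sum, mul_assoc]
  · simp [hx]

lemma ev_X_mul {q : ℕ} (n : ℕ) (f : PowerSeries (Mq q)) (z : ℂ) :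
    ev (n + 1) (PowerSeries.X * f) z = ev n f z := by
  rw [ev, ev, Finset.sum_range_succ', PowerSeries.coeff_zero_X_mul, smul_zero, add_zero]
  refine Finset.sum_congr rfl fun m _ => ?_
  rw [PowerSeries.coeff_succ_X_mul]
  congr 2
  omega

/-! ### The polynomials -/

lemma charP {q : ℕ} (s : ℕ → Mq q) (hs : ∀ j, (s j)ᴴ = s j) (n : ℕ)
    (hu : ∀ n, IsUnit (Hmat q s n)) :
    ∃ p, OP (PowerSeries.mk s) n 0 p ∧ ∀ z, Ppoly q s n z = ev (n + 1) p z ∧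
      Qpoly q s n z = ev n (PowerSeries.mk s * p) z := by
  cases n with
  | zero =>
    refine ⟨1, ⟨by simp, ?_, by omega⟩, ?_⟩
    · intro i hi
      rw [PowerSeries.coeff_one, if_neg (by omega)]
    · intro z
      simp [Ppoly, Qpoly, ev]
  | succ n =>
    refine ⟨rev (n + 1) (colH q s n), OP_colH s n 0 (hu n), ?_⟩
    intro z
    constructor
    · rw [Ppoly, evalRow (n + 1) z (fun j => if j = 0 then 1 else 0)]
      · congr 1
        convert one_mul _
        ext1 i
        simp [PowerSeries.coeff_one]
      · intro a r
        simp only [vcol, Matrix.conjTranspose_apply, Matrix.of_apply]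
        by_cases h : r.1.1 = 0
        · by_cases h2 : r.2 = a
          · subst h2; simp [h]
          · simp [h, h2, Ne.symm h2]
        · simp [h]
    · have hX : PowerSeries.mk (fun j => if j = 0 then 0 else s (j - 1)) =
          PowerSeries.X * PowerSeries.mk s := by
        ext1 i
        cases i with
        | zero => rw [PowerSeries.coeff_zero_X_mul]; simp
        | succ i => rw [PowerSeries.coeff_succ_X_mul]; simp
      rw [Qpoly, ← Matrix.neg_mul, ← Matrix.neg_mul,
        evalRow (n + 1) z (fun j => if j = 0 then 0 else s (j - 1)), hX, mul_assoc, ev_X_mul]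
      · intro a r
        simp only [ucol, Matrix.conjTranspose_apply, Matrix.of_apply, Matrix.neg_apply]
        by_cases h : r.1.1 = 0
        · simp [h]
        · simp only [h, if_false]
          rw [star_neg, neg_neg, ← Matrix.conjTranspose_apply, hs]

lemma colK_eq {q : ℕ} (s : ℕ → Mq q) (n : ℕ) : colK q s n = colH q (fun j => s (j + 1)) n := by
  have h1 : Kmat q s n = Hmat q (fun j => s (j + 1)) n := rfl
  unfold colK colH
  rw [h1]
  simp only [show ∀ x, n + 1 + x + 1 = n + 2 + x by intro x; omega]

lemma charPhat {q : ℕ} (s : ℕ → Mq q) (n : ℕ)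
    (hu : ∀ n, IsUnit (Hmat q (fun j => s (j + 1)) n)) :
    ∃ p, OP (PowerSeries.mk s) n 1 p ∧ ∀ z, Phat q s n z = ev (n + 1) p z ∧
      Qhat q s n z = ev (n + 1) (PowerSeries.mk s * p) z := by
  cases n with
  | zero =>
    refine ⟨1, ⟨by simp, ?_, by omega⟩, ?_⟩
    · intro i hi
      rw [PowerSeries.coeff_one, if_neg (by omega)]
    · intro z
      simp [Phat, Qhat, ev]
  | succ n =>
    refine ⟨rev (n + 1) (colH q (fun j => s (j + 1)) n), OP_colH s n 1 (hu n), ?_⟩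
    intro z
    constructor
    · rw [Phat, colK_eq, evalRow (n + 1) z (fun j => if j = 0 then 1 else 0)]
      · congr 1
        convert one_mul _
        ext1 i
        simp [PowerSeries.coeff_one]
      · intro a r
        simp only [vcol, Matrix.conjTranspose_apply, Matrix.of_apply]
        by_cases h : r.1.1 = 0
        · by_cases h2 : r.2 = a
          · subst h2; simp [h]
          · simp [h, h2, Ne.symm h2]
        · simp [h]
    · rw [Qhat, colK_eq, evalRow (n + 1) z s]
      intro a r
      simp [zrow]

lemma ev_C_tr {q : ℕ} (N : ℕ) (d : Mq q) (f : PowerSeries (Mq q)) (z : ℂ) :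
    ev N (PowerSeries.C d * tr N f) z = d * ev N f z := by
  simp only [ev, Finset.mul_sum]
  refine Finset.sum_congr rfl fun m hm => ?_
  rw [PowerSeries.coeff_C_mul, coeff_tr, if_pos (Finset.mem_range.mp hm), Matrix.mul_smul]

lemma ev_sub_C {q : ℕ} (N : ℕ) (c : Mq q) (f g : PowerSeries (Mq q)) (z : ℂ) :
    ev N (f - PowerSeries.C c * g) z = ev N f z - c * ev N g z := by
  simp only [ev, Finset.mul_sum, ← Finset.sum_sub_distrib]
  refine Finset.sum_congr rfl fun m hm => ?_
  rw [map_sub, PowerSeries.coeff_C_mul, Matrix.mul_smul, smul_sub]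

/-- Evaluate a series whose coefficients are a shift. -/
lemma ev_shift {q : ℕ} (n : ℕ) (f g : PowerSeries (Mq q)) (z : ℂ)
    (h0 : PowerSeries.coeff 0 g = 0)
    (h : ∀ m < n, PowerSeries.coeff m f = PowerSeries.coeff (m + 1) g) :
    ev n f z = ev (n + 1) g z := by
  rw [ev, ev, Finset.sum_range_succ', h0, smul_zero, add_zero]
  refine Finset.sum_congr rfl fun m hm => ?_
  rw [h m (Finset.mem_range.mp hm)]
  congr 2
  omega

lemma ev_tr_self {q : ℕ} (n : ℕ) (f : PowerSeries (Mq q)) (z : ℂ) :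
    ev n (tr n f) z = ev n f z := by
  refine Finset.sum_congr rfl fun m hm => ?_
  rw [coeff_tr, if_pos (Finset.mem_range.mp hm)]

lemma ev_tr_succ {q : ℕ} (n : ℕ) (f : PowerSeries (Mq q)) (z : ℂ) :
    ev (n + 1) (tr n f) z = z • ev n f z := by
  rw [ev, Finset.sum_range_succ, coeff_tr, if_neg (by omega), smul_zero, add_zero, ev,
    Finset.smul_sum]
  refine Finset.sum_congr rfl fun m hm => ?_
  have := Finset.mem_range.mp hm
  rw [coeff_tr, if_pos this, smul_smul, ← pow_succ']
  congr 2
  omega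

lemma herm_of_PD {q : ℕ} {s : ℕ → Mq q} (hs : IsStieltjesPD q s) (j : ℕ) : (s j)ᴴ = s j := by
  have h := (hs j).1.isHermitian
  ext a b
  have h2 := congrFun (congrFun h ((0 : Fin (j + 1)), a)) (Fin.last j, b)
  simpa [Hmat] using h2

lemma exact_rel {q : ℕ} {s : ℕ → Mq q} (hs : IsStieltjesPD q s) (n : ℕ) (hn : 1 ≤ n) (z : ℂ) :
    Ppoly q (katetov1 q s) n z = (s 0)⁻¹ * Qhat q s n z ∧
    Qpoly q (katetov1 q s) n z = Qhat q s n z - s 0 * Phat q s n z ∧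
    Phat q (katetov1 q s) (n - 1) z = (s 0)⁻¹ * Qpoly q s n z ∧
    Qhat q (katetov1 q s) (n - 1) z = z • Qpoly q s n z - s 0 * Ppoly q s n z := by
  have herm := herm_of_PD hs
  have hH : ∀ n, IsUnit (Hmat q s n) := fun n => (hs n).1.isUnit
  have hK : ∀ n, IsUnit (Hmat q (fun j => s (j + 1)) n) := fun n => (hs n).2.isUnit
  have U0 : ∀ n, UU (PowerSeries.mk s) n 0 := fun n => UU_of_isUnit s n 0 fun k _ => hH k
  have U1 : ∀ n, UU (PowerSeries.mk s) n 1 := fun n => UU_of_isUnit s n 1 fun k _ => hK k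
  have hu : IsUnit (s 0) := by
    rw [← Matrix.mulVec_injective_iff_isUnit]
    refine (injective_iff_map_eq_zero (Matrix.mulVecLin (s 0))).mpr ?_
    intro v hv
    have h2 := (injective_iff_map_eq_zero (Matrix.mulVecLin (Hmat q s 0))).mp
      (Matrix.mulVec_injective_iff_isUnit.mpr (hH 0))
    have h3 := h2 (fun x => v x.2) (by
      ext x
      have h4 := congrFun hv x.2
      simpa [Matrix.mulVec, dotProduct, Fintype.sum_prod_type, Hmat] using h4)
    ext i
    exact congrFun h3 (0, i)
  have hdc : (s 0)⁻¹ * s 0 = 1 := Matrix.nonsing_inv_mul _ ((Matrix.isUnit_iff_isUnit_det _).mp hu)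
  have V0 : ∀ n, UU (PowerSeries.mk (katetov1 q s)) n 0 := fun n =>
    UU_transfer hdc (kat_R s hu) (a := 0) (a' := 1) rfl (U1 _)
  have V1 : ∀ n, UU (PowerSeries.mk (katetov1 q s)) n 1 := fun n =>
    UU_transfer hdc (kat_R s hu) (a := 1) (a' := 0) rfl (U0 _)
  have h0 : PowerSeries.coeff 0 (PowerSeries.mk s) = s 0 := PowerSeries.coeff_mk 0 s
  have hc0 : ∀ N a p, 1 ≤ N → OP (PowerSeries.mk s) n a p → PowerSeries.coeff 0
      (tr N (PowerSeries.mk s * p) - PowerSeries.C (s 0) * p) = 0 := by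
    intro N a p hN hp
    rw [map_sub, coeff_tr, if_pos (by omega), PowerSeries.coeff_mul, PowerSeries.coeff_C_mul]
    simp only [Finset.Nat.antidiagonal_zero, Finset.sum_singleton, h0, sub_self]
  obtain ⟨p, hp, hpe⟩ := charP s herm n hH
  obtain ⟨p', hp', hpe'⟩ := charPhat s n hK
  obtain ⟨r, hr, hre⟩ := charP (katetov1 q s) (kat_herm s hu herm) n
    (fun n => isUnit_of_UU (katetov1 q s) n 0 (V0 _))
  obtain ⟨r', hr', hre'⟩ := charPhat (katetov1 q s) (n - 1)
    (fun n => isUnit_of_UU (katetov1 q s) n 1 (V1 _))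
  obtain ⟨k1, o1⟩ := OP_transfer hdc h0 (kat_L s hu) (a := 1) (a' := 0) (n' := n) rfl rfl hp'
  obtain ⟨k2, o2⟩ := OP_transfer hdc h0 (kat_L s hu) (a := 0) (a' := 1) (n' := n - 1) rfl
    (by omega) hp
  have e1 := OP_unique (V0 _) hr o1
  have e2 := OP_unique (V1 _) hr' o2
  rw [(hre z).1, (hre z).2, (hre' z).1, (hre' z).2, (hpe z).1, (hpe z).2, (hpe' z).1, (hpe' z).2,
    e1, e2, show n - 1 + 1 = n by omega, add_zero]
  refine ⟨ev_C_tr _ _ _ _, ?_, ev_C_tr _ _ _ _, ?_⟩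
  · rw [ev_shift n _ _ z (hc0 (n + 1) 1 p' (by omega) hp'), ev_sub_C, ev_tr_self]
    intro m hm
    rw [k1 m (by omega), map_sub, PowerSeries.coeff_C_mul]
  · rw [ev_shift n _ _ z (hc0 n 0 p (by omega) hp), ev_sub_C, ev_tr_succ]
    intro m hm
    have := k2 m (by omega)
    rw [add_zero] at this
    rw [this, map_sub, PowerSeries.coeff_C_mul]

/-- Normalized relations between the polynomials of the first Kátětov transform and those of
the original sequence. -/
theorem stmt16 (q : ℕ) (hq : 1 ≤ q) (s : ℕ → Mq q) (hs : IsStieltjesPD q s) (n : ℕ) (hn : 1 ≤ n) (z : ℂ) :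
    Ppoly q (katetov q 1 s) n z * (Ppoly q (katetov q 1 s) n 0)⁻¹ =
        ((s 0)⁻¹ * Qhat q s n z) * ((s 0)⁻¹ * Qhat q s n 0)⁻¹ ∧
      Qpoly q (katetov q 1 s) n z * (Ppoly q (katetov q 1 s) n 0)⁻¹ =
        (Qhat q s n z - s 0 * Phat q s n z) * ((s 0)⁻¹ * Qhat q s n 0)⁻¹ ∧
      Phat q (katetov q 1 s) (n - 1) z * (Qhat q (katetov q 1 s) (n - 1) 0)⁻¹ =
        ((s 0)⁻¹ * Qpoly q s n z) * (-(s 0 * Ppoly q s n 0))⁻¹ ∧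
      Qhat q (katetov q 1 s) (n - 1) z * (Qhat q (katetov q 1 s) (n - 1) 0)⁻¹ =
        (z • Qpoly q s n z - s 0 * Ppoly q s n z) * (-(s 0 * Ppoly q s n 0))⁻¹ := by
  have hk : katetov q 1 s = katetov1 q s := rfl
  obtain ⟨a1, a2, a3, a4⟩ := exact_rel hs n hn z
  obtain ⟨b1, -, -, b4⟩ := exact_rel hs n hn 0
  rw [zero_smul, zero_sub] at b4
  rw [hk, a1, a2, a3, a4, b1, b4]
  exact ⟨rfl, rfl, rfl, rfl⟩

end
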